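/- Let R be a finite ring with identity and Jacobson radical J. A point p of P(R) has exactly the same distant set as the point represented by (1,0) (that is, for every point x, x is distant to p if and only if x is distant to the class of (1,0)) if and only if p is represented by a pair (1,a) for some a ∈ J. -/

import Mathlib

/-- A pair is admissible if it is the first row of some invertible 2×2 matrix. -/
def Admissible (R : Type*) [Ring R] (v : R × R) : Prop :=
  ∃ M : Matrix (Fin 2) (Fin 2) R, IsUnit M ∧ M 0 0 = v.1 ∧ M 0 1 = v.2

/-- The type of admissible pairs. -/
def AdmissiblePair (R : Type*) [Ring R] := {v : R × R // Admissible R v}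

/-- Two admissible pairs are associated if one is obtained from the other by left
multiplication by a unit. -/
def ProjAssoc (R : Type*) [Ring R] (v w : AdmissiblePair R) : Prop :=
  ∃ u : Rˣ, v.1.1 = (u : R) * w.1.1 ∧ v.1.2 = (u : R) * w.1.2

/-- The projective line over a ring: admissible pairs modulo unit multiples. -/
def ProjLine (R : Type*) [Ring R] := Quot (ProjAssoc R)

/-- The point of the projective line determined by an admissible pair. -/
def ProjLine.mk (R : Type*) [Ring R] (v : AdmissiblePair R) : ProjLine R :=
  Quot.mk (ProjAssoc R) v

/-- Two points are distant if (for some, equivalently any, representatives) the 2×2 matrix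
formed from the representatives is invertible. -/
def Distant (R : Type*) [Ring R] (x y : ProjLine R) : Prop :=
  ∃ (a b c d : R) (h₁ : Admissible R (a, b)) (h₂ : Admissible R (c, d)),
    x = ProjLine.mk R ⟨(a, b), h₁⟩ ∧ y = ProjLine.mk R ⟨(c, d), h₂⟩ ∧
    IsUnit !![a, b; c, d]


section

variable {R : Type*} [Ring R]

theorem Matrix.isUnit_antidiagonal_one_iff (f : R) :
    IsUnit !![0, f; 1, 0] ↔ IsUnit f := by
  constructor
  · rintro ⟨u, hu⟩
    have h₁ : (u : Matrix (Fin 2) (Fin 2) R) * (↑u⁻¹ : Matrix (Fin 2) (Fin 2) R) = 1 :=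
      u.mul_inv
    have h₂ : (↑u⁻¹ : Matrix (Fin 2) (Fin 2) R) * (u : Matrix (Fin 2) (Fin 2) R) = 1 :=
      u.inv_mul
    rw [hu] at h₁ h₂
    have e₁ := congrFun (congrFun h₁ 0) 0
    have e₂ := congrFun (congrFun h₂ 1) 1
    simp [Matrix.mul_apply, Fin.sum_univ_two] at e₁ e₂
    exact ⟨⟨f, _, e₁, e₂⟩, rfl⟩
  · rintro ⟨u, rfl⟩
    refine ⟨⟨!![0, u; 1, 0], !![0, 1; ↑u⁻¹, 0], ?_, ?_⟩, rfl⟩ <;>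
      simp [Matrix.one_fin_two]

theorem Matrix.isUnit_upper_unitriangular (a : R) : IsUnit !![1, a; 0, 1] := by
  refine ⟨⟨!![1, a; 0, 1], !![1, -a; 0, 1], ?_, ?_⟩, rfl⟩ <;>
    simp [Matrix.one_fin_two]

theorem Matrix.isUnit_fin_two_of_one_left (a b e : R) :
    IsUnit !![a, b; 1, e] ↔ IsUnit (b - a * e) := by
  have h : !![a, b; 1, e] =
      !![1, a; 0, 1] * !![0, b - a * e; 1, 0] * !![1, e; 0, 1] := by
    simp
  rw [h, (Matrix.isUnit_upper_unitriangular e).mul_right_iff,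
    (Matrix.isUnit_upper_unitriangular a).mul_left_iff,
    Matrix.isUnit_antidiagonal_one_iff]

theorem Matrix.isUnit_fin_two_of_one_right (a c d : R) :
    IsUnit !![a, 1; c, d] ↔ IsUnit (c - d * a) := by
  have hs : IsUnit (!![0, 1; 1, 0] : Matrix (Fin 2) (Fin 2) R) :=
    (Matrix.isUnit_antidiagonal_one_iff 1).2 isUnit_one
  have h : !![a, 1; c, d] = !![0, 1; 1, 0] * !![d, c; 1, a] * !![0, 1; 1, 0] := by
    simp
  rw [h, hs.mul_right_iff, hs.mul_left_iff, Matrix.isUnit_fin_two_of_one_left]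

theorem admissible_of_isUnit {a b c d : R} (h : IsUnit !![a, b; c, d]) : Admissible R (a, b) :=
  ⟨_, h, rfl, rfl⟩

theorem projAssoc_equivalence (R : Type*) [Ring R] : Equivalence (ProjAssoc R) where
  refl _ := ⟨1, by simp, by simp⟩
  symm := by
    rintro v w ⟨u, h₁, h₂⟩
    exact ⟨u⁻¹, by simp [h₁], by simp [h₂]⟩
  trans := by
    rintro v w x ⟨u, h₁, h₂⟩ ⟨u', h₁', h₂'⟩
    exact ⟨u * u', by simp [h₁, h₁', mul_assoc], by simp [h₂, h₂', mul_assoc]⟩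

theorem ProjLine.mk_eq_mk_iff {v w : AdmissiblePair R} :
    ProjLine.mk R v = ProjLine.mk R w ↔ ProjAssoc R v w :=
  (projAssoc_equivalence R).quot_mk_eq_iff v w

theorem distant_mk_iff {a b c d : R} (h₁ : Admissible R (a, b)) (h₂ : Admissible R (c, d)) :
    Distant R (ProjLine.mk R ⟨(a, b), h₁⟩) (ProjLine.mk R ⟨(c, d), h₂⟩) ↔
      IsUnit !![a, b; c, d] := by
  constructor
  · rintro ⟨a', b', c', d', h₁', h₂', hx, hy, h⟩
    obtain ⟨u, hu₁, hu₂⟩ := ProjLine.mk_eq_mk_iff.1 hx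
    obtain ⟨v, hv₁, hv₂⟩ := ProjLine.mk_eq_mk_iff.1 hy
    dsimp only at hu₁ hu₂ hv₁ hv₂
    have hd : IsUnit !![(u : R), 0; 0, (v : R)] := by
      refine ⟨⟨!![(u : R), 0; 0, (v : R)], !![↑u⁻¹, 0; 0, ↑v⁻¹], ?_, ?_⟩, rfl⟩ <;>
        simp [Matrix.one_fin_two]
    have e : !![a, b; c, d] = !![(u : R), 0; 0, (v : R)] * !![a', b'; c', d'] := by
      simp [hu₁, hu₂, hv₁, hv₂]
    rw [e]
    exact hd.mul h
  · exact fun h => ⟨a, b, c, d, h₁, h₂, rfl, rfl, h⟩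

theorem isUnit_one_add_mul_swap {x y : R} (h : IsUnit (1 + x * y)) : IsUnit (1 + y * x) := by
  obtain ⟨u, hu⟩ := h
  have h₁ : (↑u⁻¹ : R) + ↑u⁻¹ * (x * y) = 1 := by
    rw [← u.inv_mul, hu, mul_add, mul_one]
  have h₂ : (↑u⁻¹ : R) + x * y * ↑u⁻¹ = 1 := by
    rw [← u.mul_inv, hu, add_mul, one_mul]
  refine ⟨⟨1 + y * x, 1 - y * ↑u⁻¹ * x, ?_, ?_⟩, rfl⟩
  · calc (1 + y * x) * (1 - y * ↑u⁻¹ * x)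
        = 1 + y * x - y * (↑u⁻¹ + x * y * ↑u⁻¹) * x := by noncomm_ring
      _ = 1 := by rw [h₂]; simp
  · calc (1 - y * ↑u⁻¹ * x) * (1 + y * x)
        = 1 + y * x - y * (↑u⁻¹ + ↑u⁻¹ * (x * y)) * x := by noncomm_ring
      _ = 1 := by rw [h₁]; simp

theorem mem_jacobson_bot_iff_isUnit_one_add_mul [IsDedekindFiniteMonoid R] {e : R} :
    e ∈ Ideal.jacobson (⊥ : Ideal R) ↔ ∀ y, IsUnit (1 + y * e) := by
  rw [Ideal.mem_jacobson_iff]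
  refine forall_congr' fun y => ⟨?_, ?_⟩
  · rintro ⟨z, hz⟩
    rw [Ideal.mem_bot, sub_eq_zero] at hz
    refine IsUnit.of_mul_eq_one_right z ?_
    rw [mul_add, mul_one, ← mul_assoc, add_comm, hz]
  · rintro ⟨u, hu⟩
    refine ⟨↑u⁻¹, ?_⟩
    rw [Ideal.mem_bot, sub_eq_zero, ← u.inv_mul, hu]
    noncomm_ring

theorem isUnit_sub_mul_iff_of_mem_jacobson_bot [IsDedekindFiniteMonoid R] {e : R}
    (he : e ∈ Ideal.jacobson (⊥ : Ideal R)) (a b : R) : IsUnit (b - a * e) ↔ IsUnit b := by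
  have key : ∀ {a b : R}, IsUnit b → IsUnit (b - a * e) := by
    rintro a _ ⟨u, rfl⟩
    have h := u.isUnit.mul (mem_jacobson_bot_iff_isUnit_one_add_mul.1 he (-(↑u⁻¹ * a)))
    convert h using 1
    simp [mul_add, mul_assoc, sub_eq_add_neg]
  exact ⟨fun h => by simpa using key (a := -a) h, key⟩

end

/-- A point of `P(R)` (for a finite ring `R`) has the same distant set as the point
`R(1,0)` iff it is represented by a pair `(1, a)` with `a` in the Jacobson radical. -/
theorem same_distant_set_iff_radical (R : Type*) [Ring R] [Fintype R]
    (p : ProjLine R) (h₀ : Admissible R (1, 0)) :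
    (∀ x : ProjLine R, Distant R x p ↔ Distant R x (ProjLine.mk R ⟨(1, 0), h₀⟩)) ↔
      ∃ a ∈ Ideal.jacobson (⊥ : Ideal R), ∃ h : Admissible R (1, a),
        p = ProjLine.mk R ⟨(1, a), h⟩ := by
  constructor
  · intro hp
    obtain ⟨⟨⟨c, d⟩, hcd⟩, rfl⟩ := Quot.exists_rep p
    have key (a : R) : IsUnit (c - d * a) := by
      have hu : IsUnit !![a, 1; 1, 0] := by
        rw [Matrix.isUnit_fin_two_of_one_left]
        simp
      have h := (hp _).2 ((distant_mk_iff (admissible_of_isUnit hu) h₀).2 hu)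
      exact (Matrix.isUnit_fin_two_of_one_right a c d).1 ((distant_mk_iff _ hcd).1 h)
    obtain ⟨u, rfl⟩ : IsUnit c := by simpa using key 0
    refine ⟨↑u⁻¹ * d, mem_jacobson_bot_iff_isUnit_one_add_mul.2 fun y => ?_,
      admissible_of_isUnit (c := 0) (d := 1) (Matrix.isUnit_upper_unitriangular _),
      ProjLine.mk_eq_mk_iff.2 ⟨u, by simp, by simp⟩⟩
    have h := u⁻¹.isUnit.mul (key (-y))
    have h' : IsUnit (1 + ↑u⁻¹ * d * y) := by
      convert h using 1
      simp [mul_add, mul_assoc]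
    exact isUnit_one_add_mul_swap h'
  · rintro ⟨e, he, h, rfl⟩ x
    obtain ⟨⟨⟨a, b⟩, hab⟩, rfl⟩ := Quot.exists_rep x
    refine (distant_mk_iff hab h).trans (Iff.trans ?_ (distant_mk_iff hab h₀).symm)
    rw [Matrix.isUnit_fin_two_of_one_left, Matrix.isUnit_fin_two_of_one_left,
      isUnit_sub_mul_iff_of_mem_jacobson_bot he, mul_zero, sub_zero]
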